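/- arXiv:2106.14584 — 5 statements merged into one kernel-verified Lean document; each statement's English description precedes it below -/
import Mathlib

section
/- Let E be a finite-dimensional real normed vector space and let C ⊆ E be a convex cone which is closed as a subset of E and salient (i.e., C ∩ (−C) ⊆ {0}). Then for every y ∈ E, the set K(y) := {x ∈ E | x ∈ C and y − x ∈ C} is compact. -/
open Filter Topology

/-- In a finite-dimensional real normed vector space, if `C` is a closed salient
convex cone, then for every `y` the "order interval" `{x | x ∈ C ∧ y - x ∈ C}`
is compact. -/
theorem stmt1 {E : Type*} [NormedAddCommGroup E] [NormedSpace ℝ E]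
    [FiniteDimensional ℝ E]
    (C : Set E)
    (hC_add : ∀ x ∈ C, ∀ y ∈ C, x + y ∈ C)
    (hC_smul : ∀ (r : ℝ), 0 < r → ∀ x ∈ C, r • x ∈ C)
    (hC_closed : IsClosed C)
    (hC_salient : ∀ x ∈ C, -x ∈ C → x = 0)
    (y : E) :
    IsCompact {x : E | x ∈ C ∧ y - x ∈ C} := by
  refine Metric.isCompact_of_isClosed_isBounded
    (hC_closed.inter (hC_closed.preimage (continuous_const.sub continuous_id))) ?_
  by_contra hunb
  have hlarge (n : ℕ) : ∃ x : E, (x ∈ C ∧ y - x ∈ C) ∧ (n : ℝ) < ‖x‖ := by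
    by_contra! h
    exact hunb (isBounded_iff_forall_norm_le.2 ⟨n, h⟩)
  choose x hx hxn using hlarge
  have hpos (n : ℕ) : 0 < ‖x n‖ := n.cast_nonneg.trans_lt (hxn n)
  have hinv : Tendsto (fun n => ‖x n‖⁻¹) atTop (𝓝 0) :=
    (tendsto_atTop_mono (fun n => (hxn n).le) tendsto_natCast_atTop_atTop).inv_tendsto_atTop
  -- A limit direction `u` of the unbounded sequence lies in both `C` and `-C`.
  obtain ⟨u, hu, φ, hφ, hlim⟩ := (isCompact_sphere (0 : E) 1).tendsto_subseq
    (x := fun n => ‖x n‖⁻¹ • x n) fun n => by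
      simp [norm_smul, (hpos n).ne']
  have huC : u ∈ C := hC_closed.mem_of_tendsto hlim <| .of_forall fun n =>
    hC_smul _ (inv_pos.2 (hpos _)) _ (hx _).1
  have hneg : Tendsto (fun n => ‖x (φ n)‖⁻¹ • (y - x (φ n))) atTop (𝓝 (-u)) := by
    simpa [smul_sub, Function.comp_def] using
      ((hinv.comp hφ.tendsto_atTop).smul_const y).sub hlim
  have hnuC : -u ∈ C := hC_closed.mem_of_tendsto hneg <| .of_forall fun n =>
    hC_smul _ (inv_pos.2 (hpos _)) _ (hx _).2
  simp [hC_salient u huC hnuC] at hu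
end

section
/- Let E be a finite-dimensional real normed vector space and let C ⊆ E be a convex cone which is closed as a subset of E and salient (i.e., C ∩ (−C) ⊆ {0}). Let (y_m)_{m∈ℕ} be a sequence in E converging to 0, and let (x_m)_{m∈ℕ} be a sequence in E such that for all m, x_m ∈ C and y_m − x_m ∈ C. Then (x_m) converges to 0. -/
/-- In a finite-dimensional real normed vector space with a closed salient convex
cone `C`, if `y_m → 0` and `x_m ∈ C` with `y_m - x_m ∈ C` for all `m`, then
`x_m → 0`. -/
theorem stmt2 {E : Type*} [NormedAddCommGroup E] [NormedSpace ℝ E]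
    [FiniteDimensional ℝ E]
    (C : Set E)
    (hC_add : ∀ x ∈ C, ∀ y ∈ C, x + y ∈ C)
    (hC_smul : ∀ (r : ℝ), 0 < r → ∀ x ∈ C, r • x ∈ C)
    (hC_closed : IsClosed C)
    (hC_salient : ∀ x ∈ C, -x ∈ C → x = 0)
    (y x : ℕ → E)
    (hy : Filter.Tendsto y Filter.atTop (nhds 0))
    (hx : ∀ m, x m ∈ C)
    (hyx : ∀ m, y m - x m ∈ C) :
    Filter.Tendsto x Filter.atTop (nhds 0) := by
  open Filter in
  by_contra h
  obtain ⟨ε, hε, hfreq⟩ : ∃ ε > 0, ∃ᶠ m in atTop, ε ≤ ‖x m‖ := by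
    rw [Metric.tendsto_nhds] at h
    push Not at h
    simpa using h
  obtain ⟨φ, hφ, hφx⟩ := extraction_of_frequently_atTop hfreq
  have hpos : ∀ n, 0 < ‖x (φ n)‖ := fun n => hε.trans_le (hφx n)
  have hsphere : ∀ n, ‖x (φ n)‖⁻¹ • x (φ n) ∈ Metric.sphere (0 : E) 1 := fun n => by
    simp [norm_smul, (hpos n).ne']
  obtain ⟨a, ha, ψ, hψ, hlim⟩ := (isCompact_sphere (0 : E) 1).tendsto_subseq hsphere
  have haC : a ∈ C := hC_closed.mem_of_tendsto hlim <|
    Eventually.of_forall fun n => hC_smul _ (inv_pos.2 (hpos _)) _ (hx _)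
  have hy_scaled : Tendsto (fun n => ‖x (φ (ψ n))‖⁻¹ • y (φ (ψ n))) atTop (nhds 0) := by
    have hy_sub := (hy.comp (hφ.comp hψ).tendsto_atTop).norm.const_mul ε⁻¹
    rw [norm_zero, mul_zero] at hy_sub
    refine squeeze_zero_norm (fun n => ?_) hy_sub
    rw [norm_smul, norm_inv, norm_norm]
    exact mul_le_mul_of_nonneg_right (inv_anti₀ hε (hφx _)) (norm_nonneg _)
  have hnegC : -a ∈ C := by
    have hsub := hy_scaled.sub hlim
    rw [zero_sub] at hsub
    refine hC_closed.mem_of_tendsto hsub (Eventually.of_forall fun n => ?_)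
    simpa only [Function.comp_apply, smul_sub] using
      hC_smul _ (inv_pos.2 (hpos (ψ n))) _ (hyx (φ (ψ n)))
  have ha0 : a = 0 := hC_salient a haC hnegC
  simp [ha0] at ha
end

section
/- Let E be a finite-dimensional real normed vector space and let C ⊆ E be a convex cone which is closed as a subset of E and salient (i.e., C ∩ (−C) ⊆ {0}). For each m ∈ ℕ let T_m : E → E be a linear map with T_m(C) ⊆ C, and let (u_m), (v_m) be sequences in E such that for all m, v_m ∈ C and u_m − v_m ∈ C. If the sequence (T_m(u_m)) converges to 0, then the sequence (T_m(v_m)) converges to 0. -/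
/-- A closed salient cone in a finite-dimensional normed space is normal: the norm of a sum of
two elements of the cone controls the norm of each summand. -/
theorem exists_pos_mul_norm_le_norm_add_of_isClosed_of_salient {E : Type*} [NormedAddCommGroup E]
    [NormedSpace ℝ E] [FiniteDimensional ℝ E] {C : Set E}
    (hC_smul : ∀ r : ℝ, 0 < r → ∀ x ∈ C, r • x ∈ C) (hC_closed : IsClosed C)
    (hC_salient : ∀ x ∈ C, -x ∈ C → x = 0) :
    ∃ δ : ℝ, 0 < δ ∧ ∀ x ∈ C, ∀ y ∈ C, δ * ‖x‖ ≤ ‖x + y‖ := by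
  rcases C.eq_empty_or_nonempty with rfl | hne
  · exact ⟨1, one_pos, by simp⟩
  have hcompact : IsCompact (C ∩ Metric.sphere (0 : E) 1) :=
    have := FiniteDimensional.proper_real E
    (isCompact_sphere 0 1).inter_left hC_closed
  have hcont : Continuous fun x : E => Metric.infDist (-x) C :=
    (Metric.continuous_infDist_pt C).comp continuous_neg
  obtain ⟨δ, hδ, hle⟩ := hcompact.exists_forall_le' hcont.continuousOn (a := 0) (by
    rintro x ⟨hx, hx1⟩
    refine (hC_closed.notMem_iff_infDist_pos hne).1 fun hneg => ?_
    simp [hC_salient x hx hneg] at hx1)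
  refine ⟨δ, hδ, fun x hx y hy => ?_⟩
  rcases eq_or_ne x 0 with rfl | hx0
  · simp
  have hpos : 0 < ‖x‖ := norm_pos_iff.2 hx0
  have hinv : 0 < ‖x‖⁻¹ := inv_pos.2 hpos
  have h₁ : δ ≤ Metric.infDist (-(‖x‖⁻¹ • x)) C :=
    hle _ ⟨hC_smul _ hinv x hx, by simp [norm_smul, hpos.ne']⟩
  have h₂ := h₁.trans (Metric.infDist_le_dist_of_mem (hC_smul _ hinv y hy))
  rw [dist_comm, dist_eq_norm, sub_neg_eq_add, add_comm, ← smul_add, norm_smul, norm_inv,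
    norm_norm, inv_mul_eq_div, le_div_iff₀ hpos] at h₂
  exact h₂

/-- Let `C` be a closed salient convex cone in a finite-dimensional real normed
vector space. If `T_m` are linear maps preserving `C`, and `v_m ∈ C`,
`u_m - v_m ∈ C`, then `T_m (u_m) → 0` implies `T_m (v_m) → 0`. -/
theorem stmt3 {E : Type*} [NormedAddCommGroup E] [NormedSpace ℝ E]
    [FiniteDimensional ℝ E]
    (C : Set E)
    (hC_add : ∀ x ∈ C, ∀ y ∈ C, x + y ∈ C)
    (hC_smul : ∀ (r : ℝ), 0 < r → ∀ x ∈ C, r • x ∈ C)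
    (hC_closed : IsClosed C)
    (hC_salient : ∀ x ∈ C, -x ∈ C → x = 0)
    (T : ℕ → E →ₗ[ℝ] E)
    (hT : ∀ m, ∀ x ∈ C, T m x ∈ C)
    (u v : ℕ → E)
    (hv : ∀ m, v m ∈ C)
    (huv : ∀ m, u m - v m ∈ C)
    (hTu : Filter.Tendsto (fun m => T m (u m)) Filter.atTop (nhds 0)) :
    Filter.Tendsto (fun m => T m (v m)) Filter.atTop (nhds 0) := by
  obtain ⟨δ, hδ, hle⟩ :=
    exists_pos_mul_norm_le_norm_add_of_isClosed_of_salient hC_smul hC_closed hC_salient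
  refine squeeze_zero_norm (a := fun m => ‖T m (u m)‖ / δ) (fun m => ?_) ?_
  · rw [le_div_iff₀' hδ]
    have h := hle _ (hT m _ (hv m)) _ (hT m _ (huv m))
    rwa [← map_add, add_sub_cancel] at h
  · simpa using hTu.norm.div_const δ
end

section
/- Let E be a finite-dimensional real normed vector space and let C ⊆ E be a nonempty open convex cone whose closure C̄ is salient (i.e., C̄ ∩ (−C̄) ⊆ {0}). For each m ∈ ℕ let T_m : E → E be a linear map with T_m(C̄) ⊆ C̄. Let (k_m) and (k'_m) be sequences of elements of C converging respectively to points k and k' of C. If the sequence (T_m(k_m)) converges to 0, then the sequence (T_m(k'_m)) converges to 0. -/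
/-- In a salient closed cone, the norm of a summand is controlled by the norm of the sum. -/
theorem exists_pos_mul_norm_le_norm_add {E : Type*} [NormedAddCommGroup E] [NormedSpace ℝ E]
    [FiniteDimensional ℝ E] {K : Set E} (hK : IsClosed K)
    (hsmul : ∀ r : ℝ, 0 < r → ∀ x ∈ K, r • x ∈ K)
    (hsal : ∀ x ∈ K, -x ∈ K → x = 0) :
    ∃ c : ℝ, 0 < c ∧ ∀ x ∈ K, ∀ y ∈ K, c * ‖x‖ ≤ ‖x + y‖ := by
  have : ProperSpace E := FiniteDimensional.proper ℝ E
  rcases K.eq_empty_or_nonempty with rfl | hne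
  · exact ⟨1, one_pos, by simp⟩
  have hcomp : IsCompact (Metric.sphere (0 : E) 1 ∩ K) :=
    (isCompact_sphere 0 1).inter_right hK
  have hpos : ∀ x ∈ Metric.sphere (0 : E) 1 ∩ K, 0 < Metric.infDist x (-K) := by
    rintro x ⟨hx1, hxK⟩
    refine (hK.neg.notMem_iff_infDist_pos hne.neg).1 fun hx => ?_
    simp [hsal x hxK hx] at hx1
  obtain ⟨c, hc, hcle⟩ :=
    hcomp.exists_forall_le' (Metric.continuous_infDist_pt (-K)).continuousOn hpos
  refine ⟨c, hc, fun x hx y hy => ?_⟩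
  rcases eq_or_ne x 0 with rfl | hx0
  · simp
  have hn : 0 < ‖x‖ := norm_pos_iff.2 hx0
  have hi : 0 < ‖x‖⁻¹ := inv_pos.2 hn
  have h1 : c ≤ Metric.infDist (‖x‖⁻¹ • x) (-K) :=
    hcle _ ⟨by simp [norm_smul, hn.ne'], hsmul _ hi x hx⟩
  have h2 : Metric.infDist (‖x‖⁻¹ • x) (-K) ≤ dist (‖x‖⁻¹ • x) (-(‖x‖⁻¹ • y)) :=
    Metric.infDist_le_dist_of_mem (by simpa using hsmul _ hi y hy)
  rw [dist_eq_norm, sub_neg_eq_add, ← smul_add, norm_smul, norm_inv, norm_norm] at h2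
  calc c * ‖x‖ ≤ ‖x‖⁻¹ * ‖x + y‖ * ‖x‖ := by gcongr; exact h1.trans h2
    _ = ‖x + y‖ := by field_simp

/-- Contraction in corners (abstract form): let `C` be a nonempty open convex cone
in a finite-dimensional real normed vector space whose closure is salient, and let
`T_m` be linear maps preserving the closure of `C`. If `k_m → k ∈ C` and
`k'_m → k' ∈ C` are sequences in `C` and `T_m (k_m) → 0`, then `T_m (k'_m) → 0`. -/
theorem stmt5 {E : Type*} [NormedAddCommGroup E] [NormedSpace ℝ E]
    [FiniteDimensional ℝ E]
    (C : Set E)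
    (hC_add : ∀ x ∈ C, ∀ y ∈ C, x + y ∈ C)
    (hC_smul : ∀ (r : ℝ), 0 < r → ∀ x ∈ C, r • x ∈ C)
    (hC_open : IsOpen C) (hC_ne : C.Nonempty)
    (hC_salient : ∀ x ∈ closure C, -x ∈ closure C → x = 0)
    (T : ℕ → E →ₗ[ℝ] E)
    (hT : ∀ m, ∀ x ∈ closure C, T m x ∈ closure C)
    (k k' : E) (hk : k ∈ C) (hk' : k' ∈ C)
    (km k'm : ℕ → E) (hkm : ∀ m, km m ∈ C) (hk'm : ∀ m, k'm m ∈ C)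
    (hkm_lim : Filter.Tendsto km Filter.atTop (nhds k))
    (hk'm_lim : Filter.Tendsto k'm Filter.atTop (nhds k'))
    (hTk : Filter.Tendsto (fun m => T m (km m)) Filter.atTop (nhds 0)) :
    Filter.Tendsto (fun m => T m (k'm m)) Filter.atTop (nhds 0) := by
  have hsmul : ∀ r : ℝ, 0 < r → ∀ x ∈ closure C, r • x ∈ closure C := fun r hr x hx =>
    map_mem_closure (continuous_const_smul r) hx (hC_smul r hr)
  obtain ⟨c, hc, hle⟩ := exists_pos_mul_norm_le_norm_add isClosed_closure hsmul hC_salient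
  have hε : ∀ᶠ ε : ℝ in nhdsWithin 0 (Set.Ioi 0), k - ε • k' ∈ C := by
    have hcont : Continuous fun ε : ℝ => k - ε • k' := by fun_prop
    exact nhdsWithin_le_nhds
      (hcont.continuousAt.eventually_mem (hC_open.mem_nhds (by simpa using hk)))
  obtain ⟨ε, hεC, hε0 : 0 < ε⟩ := (hε.and self_mem_nhdsWithin).exists
  have hev : ∀ᶠ m in Filter.atTop, km m - ε • k'm m ∈ C :=
    (hkm_lim.sub (hk'm_lim.const_smul ε)).eventually_mem (hC_open.mem_nhds hεC)
  refine squeeze_zero_norm' (a := fun m => (c * ε)⁻¹ * ‖T m (km m)‖) ?_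
    (by simpa using hTk.norm.const_mul (c * ε)⁻¹)
  filter_upwards [hev] with m hm
  have h := hle _ (hsmul ε hε0 _ (hT m _ (subset_closure (hk'm m)))) _
    (hT m _ (subset_closure hm))
  rw [map_sub, map_smul, add_sub_cancel, norm_smul, Real.norm_of_nonneg hε0.le, ← mul_assoc] at h
  rwa [le_inv_mul_iff₀ (mul_pos hc hε0)]
end

section
/- Let (W, (s_i)_{i∈B}) be a Coxeter system with W a finite group, and let ℓ denote the length function on W with respect to the simple reflections (s_i)_{i∈B}. Let w ∈ W satisfy w * w = 1 (w is an involution). If there exists v ∈ W with ℓ(v) > ℓ(w) (i.e., w is not an element of maximal length in W), then there exist a proper subset J ⊊ B and an element g ∈ W such that g * w * g⁻¹ belongs to the subgroup of W generated by {s_j : j ∈ J}. -/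
theorem Function.End.mul_apply' {α : Type*} (f g : Function.End α) (x : α) :
    (f * g) x = f (g x) := rfl

theorem Function.End.one_apply' {α : Type*} (x : α) : (1 : Function.End α) x = x := rfl

open scoped Classical in
/-- The action of the simple reflection `s i` on pairs (element of `W`, parity): conjugate the
element, and flip the parity exactly at `s i`. -/
noncomputable def CoxeterSystem.parityStep {B W : Type*} [Group W] {M : CoxeterMatrix B}
    (cs : CoxeterSystem M W) (i : B) : Function.End (W × ZMod 2) :=
  fun p ↦ (cs.simple i * p.1 * cs.simple i, p.2 + if p.1 = cs.simple i then 1 else 0)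

namespace CoxeterSystem

variable {B W : Type*} [Group W] {M : CoxeterMatrix B} (cs : CoxeterSystem M W)

theorem simple_mul_pow_conj (i j : B) (n : ℕ) :
    ((cs.simple i * cs.simple j) ^ n)⁻¹ * cs.simple j * (cs.simple i * cs.simple j) ^ n =
      cs.simple j * (cs.simple i * cs.simple j) ^ (2 * n) := by
  have h : SemiconjBy (cs.simple j) (cs.simple i * cs.simple j)
      (cs.simple i * cs.simple j)⁻¹ := by
    simp [SemiconjBy, mul_assoc]
  have h' := (h.pow_right n).eq
  rw [two_mul, pow_add, ← mul_assoc, h', inv_pow]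

open scoped Classical in
theorem parityStep_mul_pow_apply (i j : B) (n : ℕ) (p : W × ZMod 2) :
    ((cs.parityStep i * cs.parityStep j) ^ n) p =
      ((cs.simple i * cs.simple j) ^ n * p.1 * ((cs.simple i * cs.simple j) ^ n)⁻¹,
        p.2 + ∑ k ∈ Finset.range (2 * n),
          if p.1 = cs.simple j * (cs.simple i * cs.simple j) ^ k then 1 else 0) := by
  induction n with
  | zero => simp [Function.End.one_apply']
  | succ n ih =>
    rw [pow_succ', Function.End.mul_apply', ih, Function.End.mul_apply', mul_add, mul_one,
      Finset.sum_range_succ, Finset.sum_range_succ]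
    set r := cs.simple i * cs.simple j with hr
    have h₁ : r ^ n * p.1 * (r ^ n)⁻¹ = cs.simple j ↔ p.1 = cs.simple j * r ^ (2 * n) := by
      rw [hr, ← simple_mul_pow_conj, ← hr]
      constructor <;> intro h
      · rw [← h]; group
      · rw [h]; group
    have h₂ : cs.simple j * (r ^ n * p.1 * (r ^ n)⁻¹) * cs.simple j = cs.simple i ↔
        p.1 = cs.simple j * r ^ (2 * n + 1) := by
      have key : cs.simple j * r ^ (2 * n + 1) =
          (r ^ n)⁻¹ * (cs.simple j * cs.simple i * cs.simple j) * r ^ n := by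
        rw [pow_succ, ← mul_assoc, hr, ← simple_mul_pow_conj, ← hr]
        have : cs.simple j * cs.simple i * cs.simple j = cs.simple j * r := by
          rw [hr, mul_assoc]
        rw [this]
        simp only [mul_assoc, (Commute.self_pow r n).eq]
      rw [key]
      constructor <;> intro h
      · rw [← h]
        simp [mul_assoc]
      · rw [h]
        simp [mul_assoc]
    simp only [parityStep, h₁, h₂]
    refine Prod.ext ?_ ?_
    · simp [pow_succ', hr, mul_assoc]
    · simp only [add_assoc]

open scoped Classical in
theorem isLiftable_parityStep : M.IsLiftable cs.parityStep := by
  intro i j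
  have h := cs.simple_mul_simple_pow i j
  generalize M i j = m at h ⊢
  funext p
  have hshift : ∀ k, (if p.1 = cs.simple j * (cs.simple i * cs.simple j) ^ (m + k)
      then (1 : ZMod 2) else 0) =
        if p.1 = cs.simple j * (cs.simple i * cs.simple j) ^ k then 1 else 0 :=
    fun k ↦ by rw [pow_add, h, one_mul]
  rw [parityStep_mul_pow_apply, h, two_mul, Finset.sum_range_add,
    Finset.sum_congr rfl fun k _ ↦ hshift k, CharTwo.add_self_eq_zero]
  simp [Function.End.one_apply']

/-- The action of `W` on pairs (element of `W`, parity) underlying the exchange property. -/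
noncomputable def parityAction : W →* Function.End (W × ZMod 2) :=
  cs.lift ⟨cs.parityStep, cs.isLiftable_parityStep⟩

/-- The parity of the number of occurrences of `t` in the right inversion sequence of any word
representing `w`. -/
noncomputable def inversionParity (w t : W) : ZMod 2 := (cs.parityAction w (t, 0)).2

theorem parityAction_simple (i : B) : cs.parityAction (cs.simple i) = cs.parityStep i :=
  cs.lift_apply_simple cs.isLiftable_parityStep i

open scoped Classical in
theorem parityAction_wordProd (ω : List B) (p : W × ZMod 2) :
    cs.parityAction (cs.wordProd ω) p =
      (cs.wordProd ω * p.1 * (cs.wordProd ω)⁻¹,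
        p.2 + ((cs.rightInvSeq ω).count p.1 : ℕ)) := by
  induction ω with
  | nil => simp [Function.End.one_apply']
  | cons i ω ih =>
    rw [wordProd_cons, map_mul, Function.End.mul_apply', ih,
      parityAction_simple, rightInvSeq, List.count_cons]
    refine Prod.ext ?_ ?_
    · simp [parityStep, mul_assoc]
    · have h : cs.wordProd ω * p.1 * (cs.wordProd ω)⁻¹ = cs.simple i ↔
          (cs.wordProd ω)⁻¹ * cs.simple i * cs.wordProd ω = p.1 := by
        constructor <;> intro h
        · rw [← h]; group
        · rw [← h]; group
      simp [parityStep, h, add_assoc]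

theorem parityAction_apply (w : W) (p : W × ZMod 2) :
    cs.parityAction w p = (w * p.1 * w⁻¹, p.2 + cs.inversionParity w p.1) := by
  obtain ⟨ω, rfl⟩ := cs.wordProd_surjective w
  simp [inversionParity, parityAction_wordProd]

theorem inversionParity_mul (u v t : W) :
    cs.inversionParity (u * v) t =
      cs.inversionParity v t + cs.inversionParity u (v * t * v⁻¹) := by
  rw [inversionParity, map_mul, Function.End.mul_apply', parityAction_apply,
    parityAction_apply]
  simp

open scoped Classical in
theorem inversionParity_simple (i : B) (t : W) :
    cs.inversionParity (cs.simple i) t = if t = cs.simple i then 1 else 0 := by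
  simp [inversionParity, parityAction_simple, parityStep]

theorem isRightDescent_of_inversionParity_ne_zero {w : W} {i : B}
    (h : cs.inversionParity w (cs.simple i) ≠ 0) : cs.IsRightDescent w i := by
  classical
  obtain ⟨ω, hω, rfl⟩ := cs.exists_isReduced w
  rw [← isRightInversion_simple_iff_isRightDescent]
  refine cs.isRightInversion_of_mem_rightInvSeq hω ?_
  by_contra hmem
  exact h (by simp [inversionParity, parityAction_wordProd, List.count_eq_zero_of_not_mem hmem])

theorem isRightDescent_iff_inversionParity_eq_one {w : W} {i : B} :
    cs.IsRightDescent w i ↔ cs.inversionParity w (cs.simple i) = 1 := by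
  refine ⟨fun h ↦ ?_, fun h ↦ cs.isRightDescent_of_inversionParity_ne_zero (by simp [h])⟩
  by_contra hne
  have h0 : cs.inversionParity w (cs.simple i) = 0 := by
    generalize cs.inversionParity w (cs.simple i) = x at hne
    revert x; decide
  refine cs.isRightDescent_iff_not_isRightDescent_mul.mp h
    (cs.isRightDescent_of_inversionParity_ne_zero ?_)
  simp [inversionParity_mul, inversionParity_simple, h0]

theorem simple_mul_eq_mul_simple_of_isRightDescent {w : W} {i : B} (h : cs.IsRightDescent w i)
    (h' : ¬ cs.IsRightDescent (cs.simple i * w) i) :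
    cs.simple i * w = w * cs.simple i := by
  rw [isRightDescent_iff_inversionParity_eq_one] at h h'
  rw [inversionParity_mul, inversionParity_simple, h] at h'
  by_contra hne
  refine h' ?_
  rw [if_neg, add_zero]
  intro heq
  exact hne (mul_inv_eq_iff_eq_mul.mp heq).symm

theorem length_mul_inv_add_length_of_central {w : W} (hdesc : ∀ i, cs.IsRightDescent w i)
    (hcomm : ∀ v, Commute w v) (v : W) :
    cs.length (w * v⁻¹) + cs.length v = cs.length w := by
  induction hn : cs.length v generalizing v with
  | zero =>
    rw [length_eq_zero_iff] at hn
    simp [hn]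
  | succ n ih =>
    obtain ⟨i, hi⟩ := cs.exists_leftDescent_of_ne_one (w := v) (by rintro rfl; simp at hn)
    have hlen := cs.isLeftDescent_iff.mp hi
    have hu := ih (cs.simple i * v) (by omega)
    rw [isLeftDescent_iff_not_isLeftDescent_mul, ← isRightDescent_inv_iff,
      isRightDescent_iff_inversionParity_eq_one] at hi
    have hd : cs.IsRightDescent (w * (cs.simple i * v)⁻¹) i := by
      apply isRightDescent_of_inversionParity_ne_zero
      rw [(hcomm _).eq, inversionParity_mul, (hcomm _).eq, mul_inv_cancel_right,
        cs.isRightDescent_iff_inversionParity_eq_one.mp (hdesc i)]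
      generalize cs.inversionParity (cs.simple i * v)⁻¹ (cs.simple i) = x at hi
      revert x; decide
    rw [isRightDescent_iff] at hd
    simp only [mul_inv_rev, inv_simple, ← mul_assoc, simple_mul_simple_cancel_right] at hd hu
    omega

theorem mem_closure_of_commute_rightDescents {w : W}
    (hcomm : ∀ i, cs.IsRightDescent w i → cs.simple i * w = w * cs.simple i) :
    w ∈ Subgroup.closure (cs.simple '' {i | cs.IsRightDescent w i}) := by
  suffices H : ∀ n a b, cs.length b = n → w = a * b →
      cs.length a + cs.length b = cs.length w →
      a ∈ Subgroup.closure (cs.simple '' {i | cs.IsRightDescent w i}) →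
      w ∈ Subgroup.closure (cs.simple '' {i | cs.IsRightDescent w i}) from
    H _ 1 w rfl (by simp) (by simp) (one_mem _)
  intro n
  induction n with
  | zero =>
    intro a b hb hab _ ha
    rw [length_eq_zero_iff] at hb
    rw [hab, hb, mul_one]
    rwa [hab, hb, mul_one] at ha
  | succ n ih =>
    intro a b hb hab hlen ha
    obtain ⟨i, hi⟩ := cs.exists_rightDescent_of_ne_one (w := b) (by rintro rfl; simp at hb)
    rw [isRightDescent_iff] at hi
    have hwi : w * cs.simple i = a * (b * cs.simple i) := by rw [hab, mul_assoc]
    have hd : cs.IsRightDescent w i := by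
      have := cs.length_mul_le a (b * cs.simple i)
      rw [IsRightDescent, hwi]
      omega
    have hw : w = cs.simple i * a * (b * cs.simple i) := by
      rw [mul_assoc, ← hwi, ← hcomm i hd, simple_mul_simple_cancel_left]
    refine ih (cs.simple i * a) (b * cs.simple i) (by omega) hw ?_
      (mul_mem (Subgroup.subset_closure ⟨i, hd, rfl⟩) ha)
    have h₁ := cs.length_mul_le (cs.simple i * a) (b * cs.simple i)
    have h₂ := cs.length_mul_le (cs.simple i) a
    rw [← hw] at h₁
    rw [length_simple] at h₂
    omega

theorem commute_rightDescents_of_length_le_conj {w : W} (hw : w * w = 1)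
    (hmin : ∀ g, cs.length w ≤ cs.length (g * w * g⁻¹)) (i : B) (hi : cs.IsRightDescent w i) :
    cs.simple i * w = w * cs.simple i := by
  refine cs.simple_mul_eq_mul_simple_of_isRightDescent hi fun h ↦ ?_
  have hl : cs.IsLeftDescent w i := by
    rwa [← isRightDescent_inv_iff, inv_eq_of_mul_eq_one_left hw]
  rw [IsLeftDescent] at hl
  rw [IsRightDescent] at h
  have := hmin (cs.simple i)
  rw [inv_simple] at this
  omega

end CoxeterSystem


/-- In a finite Coxeter group, every involution which is not of maximal length is
conjugate into a proper standard parabolic subgroup: there are a proper subset `J`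
of the index set of simple reflections and `g ∈ W` with `g * w * g⁻¹` in the
subgroup generated by the simple reflections indexed by `J`. -/
theorem stmt8 {B : Type*} {W : Type*} [Group W] [Finite W]
    {M : CoxeterMatrix B} (cs : CoxeterSystem M W)
    (w : W) (hw : w * w = 1)
    (hnotmax : ∃ v : W, cs.length w < cs.length v) :
    ∃ J : Set B, J ≠ Set.univ ∧
      ∃ g : W, g * w * g⁻¹ ∈ Subgroup.closure (cs.simple '' J) := by
  set g := Function.argmin fun g ↦ cs.length (g * w * g⁻¹) with hg
  set x := g * w * g⁻¹ with hx
  have hle : ∀ h, cs.length x ≤ cs.length (h * w * h⁻¹) := fun h ↦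
    Function.argmin_le (fun g ↦ cs.length (g * w * g⁻¹)) h
  have hxx : x * x = 1 := by
    rw [hx, conj_mul, hw, mul_one, mul_inv_cancel]
  have hcomm := cs.commute_rightDescents_of_length_le_conj hxx fun h ↦ by
    simpa [hx, mul_assoc] using hle (h * g)
  refine ⟨{i | cs.IsRightDescent x i}, fun huniv ↦ ?_, g,
    cs.mem_closure_of_commute_rightDescents hcomm⟩
  have hdesc : ∀ i, cs.IsRightDescent x i := fun i ↦ huniv.ge (Set.mem_univ i)
  have hcentral : ∀ v, Commute x v := fun v ↦
    cs.simple_induction v (fun i ↦ (hcomm i (hdesc i)).symm) (Commute.one_right x)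
      fun _ _ h h' ↦ h.mul_right h'
  obtain ⟨v, hv⟩ := hnotmax
  have h₁ := cs.length_mul_inv_add_length_of_central hdesc hcentral v
  have h₂ := hle 1
  simp only [one_mul, inv_one, mul_one] at h₂
  omega
end
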